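/- Let n ≥ 4 be even and let f : Fin n × Fin n → Fin 3 be a critical configuration with largest corner D, whose second robot r_2 occupies node u before its move according to the movement rule toward D and node w after it. Then u does not lie on side DA (its second coordinate is nonzero) and w does not lie on side DA. -/

import Mathlib

/-! ## Basic definitions: configurations on the n×n grid, reading sequences,
symmetries of the square, and the configuration classes from the paper. -/

theorem sidePos {n : ℕ} (k : Fin (n * n)) : 0 < n := by
  rcases Nat.eq_zero_or_pos n with h | h
  · exact absurd k.2 (by simp [h])
  · exact h

/-- For an index `k = n*j + i` (column-major reading), the row `i = k % n`. -/
def rowOf {n : ℕ} (k : Fin (n * n)) : Fin n :=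
  ⟨k.val % n, Nat.mod_lt _ (sidePos k)⟩

/-- For an index `k = n*j + i` (column-major reading), the column `j = k / n`. -/
def colOf {n : ℕ} (k : Fin (n * n)) : Fin n :=
  ⟨k.val / n, (Nat.div_lt_iff_lt_mul (sidePos k)).2 k.2⟩

/-- λ_DA(n·j+i) = f(i,j) -/
def lamDA {n : ℕ} (f : Fin n × Fin n → Fin 3) : Fin (n * n) → Fin 3 :=
  fun k => f (rowOf k, colOf k)

/-- λ_DC(n·i+j) = f(i,j) -/
def lamDC {n : ℕ} (f : Fin n × Fin n → Fin 3) : Fin (n * n) → Fin 3 :=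
  fun k => f (colOf k, rowOf k)

/-- λ_AD(n·j+i) = f(n-1-i,j) -/
def lamAD {n : ℕ} (f : Fin n × Fin n → Fin 3) : Fin (n * n) → Fin 3 :=
  fun k => f ((rowOf k).rev, colOf k)

/-- λ_AB(n·i+j) = f(n-1-i,j) -/
def lamAB {n : ℕ} (f : Fin n × Fin n → Fin 3) : Fin (n * n) → Fin 3 :=
  fun k => f ((colOf k).rev, rowOf k)

/-- λ_BA(n·j+i) = f(n-1-i,n-1-j) -/
def lamBA {n : ℕ} (f : Fin n × Fin n → Fin 3) : Fin (n * n) → Fin 3 :=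
  fun k => f ((rowOf k).rev, (colOf k).rev)

/-- λ_BC(n·i+j) = f(n-1-i,n-1-j) -/
def lamBC {n : ℕ} (f : Fin n × Fin n → Fin 3) : Fin (n * n) → Fin 3 :=
  fun k => f ((colOf k).rev, (rowOf k).rev)

/-- λ_CB(n·j+i) = f(i,n-1-j) -/
def lamCB {n : ℕ} (f : Fin n × Fin n → Fin 3) : Fin (n * n) → Fin 3 :=
  fun k => f (rowOf k, (colOf k).rev)

/-- λ_CD(n·i+j) = f(i,n-1-j) -/
def lamCD {n : ℕ} (f : Fin n × Fin n → Fin 3) : Fin (n * n) → Fin 3 :=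
  fun k => f (colOf k, (rowOf k).rev)

/-- horizontal reflection h(i,j) = (n-1-i, j) -/
def symH {n : ℕ} (p : Fin n × Fin n) : Fin n × Fin n := (p.1.rev, p.2)

/-- vertical reflection v(i,j) = (i, n-1-j) -/
def symV {n : ℕ} (p : Fin n × Fin n) : Fin n × Fin n := (p.1, p.2.rev)

/-- half turn r2(i,j) = (n-1-i, n-1-j) -/
def symR2 {n : ℕ} (p : Fin n × Fin n) : Fin n × Fin n := (p.1.rev, p.2.rev)

/-- quarter turn r1(i,j) = (j, n-1-i) -/
def symR1 {n : ℕ} (p : Fin n × Fin n) : Fin n × Fin n := (p.2, p.1.rev)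

/-- quarter turn r1⁻¹(i,j) = (n-1-j, i) -/
def symR1inv {n : ℕ} (p : Fin n × Fin n) : Fin n × Fin n := (p.2.rev, p.1)

/-- diagonal reflection d(i,j) = (j, i) -/
def symD {n : ℕ} (p : Fin n × Fin n) : Fin n × Fin n := (p.2, p.1)

/-- antidiagonal reflection a(i,j) = (n-1-j, n-1-i) -/
def symA {n : ℕ} (p : Fin n × Fin n) : Fin n × Fin n := (p.2.rev, p.1.rev)

/-- `f` is asymmetric: not invariant under any non-identity symmetry of the square. -/
def Asymmetric {n : ℕ} (f : Fin n × Fin n → Fin 3) : Prop :=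
  ∀ σ ∈ [symH (n := n), symV, symR2, symR1, symR1inv, symD, symA], f ≠ f ∘ σ

/-- `f` is partitive: invariant under one of h, v, r1, r1⁻¹, r2. -/
def PartitiveSq {n : ℕ} (f : Fin n × Fin n → Fin 3) : Prop :=
  ∃ σ ∈ [symH (n := n), symV, symR1, symR1inv, symR2], f = f ∘ σ

/-- all four corner nodes are empty -/
def CornersEmpty {n : ℕ} (f : Fin n × Fin n → Fin 3) : Prop :=
  ∀ p : Fin n × Fin n, (p.1.val = 0 ∨ p.1.val = n - 1) → (p.2.val = 0 ∨ p.2.val = n - 1) → f p = 0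

/-- `f` takes no value 2 (no multiplicities) -/
def NoMult {n : ℕ} (f : Fin n × Fin n → Fin 3) : Prop := ∀ p, f p ≠ 2

/-- λ_DA is lexicographically strictly greater than the other seven reading sequences -/
def DAStrictMax {n : ℕ} (f : Fin n × Fin n → Fin 3) : Prop :=
  ∀ s ∈ [lamDC f, lamAD f, lamAB f, lamBA f, lamBC f, lamCB f, lamCD f],
    toLex s < toLex (lamDA f)

/-- λ_DA is lexicographically largest among the eight reading sequences -/
def DAMax {n : ℕ} (f : Fin n × Fin n → Fin 3) : Prop :=
  ∀ s ∈ [lamDC f, lamAD f, lamAB f, lamBA f, lamBC f, lamCB f, lamCD f],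
    toLex s ≤ toLex (lamDA f)

/-- replace the first nonzero entry of a sequence by 0 -/
def zeroFirst {N : ℕ} (s : Fin N → Fin 3) : Fin N → Fin 3 :=
  fun k => if s k ≠ 0 ∧ ∀ j < k, s j = 0 then 0 else s k

/-- `s` attains the lexicographic maximum of the four corner sequences
{λ_AD, λ_AB, λ_CB, λ_CD} of `f`. -/
def AttainsMax4 {n : ℕ} (f : Fin n × Fin n → Fin 3) (s : Fin (n * n) → Fin 3) : Prop :=
  ∀ t ∈ [lamAD f, lamAB f, lamCB f, lamCD f], toLex t ≤ toLex s

/-- A is the second largest corner: the max of the four corner sequences is attained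
by λ_AD or λ_AB -/
def SecondIsA {n : ℕ} (f : Fin n × Fin n → Fin 3) : Prop :=
  AttainsMax4 f (lamAD f) ∨ AttainsMax4 f (lamAB f)

/-- C is the second largest corner -/
def SecondIsC {n : ℕ} (f : Fin n × Fin n → Fin 3) : Prop :=
  AttainsMax4 f (lamCB f) ∨ AttainsMax4 f (lamCD f)

/-- the row i = 0 (side DC) contains at least one robot -/
def Row0HasRobot {n : ℕ} (f : Fin n × Fin n → Fin 3) : Prop :=
  ∃ p : Fin n × Fin n, p.1.val = 0 ∧ f p ≠ 0

/-- almost symmetric of the first type, largest corner D -/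
def AlmostSym1 {n : ℕ} (f : Fin n × Fin n → Fin 3) : Prop :=
  CornersEmpty f ∧ NoMult f ∧ Asymmetric f ∧ DAStrictMax f ∧ Row0HasRobot f ∧
    zeroFirst (lamDA f) = zeroFirst (lamDC f)

/-- almost symmetric of the second type, largest corner D (second largest corner A or C) -/
def AlmostSym2 {n : ℕ} (f : Fin n × Fin n → Fin 3) : Prop :=
  CornersEmpty f ∧ NoMult f ∧ Asymmetric f ∧ DAStrictMax f ∧
    ((SecondIsA f ∧ zeroFirst (lamAD f) = zeroFirst (lamAB f)) ∨
     (SecondIsC f ∧ zeroFirst (lamCB f) = zeroFirst (lamCD f)))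

/-- almost symmetric of the second type with largest corner D and second largest corner A -/
def AlmostSym2A {n : ℕ} (f : Fin n × Fin n → Fin 3) : Prop :=
  CornersEmpty f ∧ NoMult f ∧ Asymmetric f ∧ DAStrictMax f ∧ SecondIsA f ∧
    zeroFirst (lamAD f) = zeroFirst (lamAB f)

/-- symmetric of the first type, largest corner D -/
def SymFirstType {n : ℕ} (f : Fin n × Fin n → Fin 3) : Prop :=
  CornersEmpty f ∧ f = f ∘ symD ∧ ¬ PartitiveSq f ∧ DAMax f

/-- symmetric of the second type, largest corner D -/
def SymSecondType {n : ℕ} (f : Fin n × Fin n → Fin 3) : Prop :=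
  CornersEmpty f ∧ f = f ∘ symA ∧ ¬ PartitiveSq f ∧ DAMax f

/-- symmetric of the second type, largest corner D and second largest corner A -/
def SymSecondTypeA {n : ℕ} (f : Fin n × Fin n → Fin 3) : Prop :=
  SymSecondType f ∧ SecondIsA f

/-- purely asymmetric with largest corner D -/
def PurelyAsym {n : ℕ} (f : Fin n × Fin n → Fin 3) : Prop :=
  CornersEmpty f ∧ Asymmetric f ∧ DAStrictMax f ∧ ¬ AlmostSym1 f ∧ ¬ AlmostSym2 f

/-- position of a node in the λ_DA reading order -/
def idxDA {n : ℕ} (p : Fin n × Fin n) : ℕ := n * p.2.val + p.1.val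

/-- `u` is the first occupied node of `f` in λ_DA-order -/
def FirstRobot {n : ℕ} (f : Fin n × Fin n → Fin 3) (u : Fin n × Fin n) : Prop :=
  f u ≠ 0 ∧ ∀ p, f p ≠ 0 → idxDA u ≤ idxDA p

/-- `u₂` is the second occupied node of `f` in λ_DA-order (after `u₁`) -/
def SecondRobot {n : ℕ} (f : Fin n × Fin n → Fin 3) (u₁ u₂ : Fin n × Fin n) : Prop :=
  f u₂ ≠ 0 ∧ u₂ ≠ u₁ ∧ ∀ p, f p ≠ 0 → p ≠ u₁ → idxDA u₂ ≤ idxDA p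

/-- destination of the one-step movement rule toward D for a robot at node `p = (i,j)`:
columnwise to (i-1,j) if j = 0, or (j = 1 and i > 1), or (i = n-1 and j+1 ≤ n/2);
otherwise rowwise to (i, j-1). -/
def destD {n : ℕ} (p : Fin n × Fin n) : Fin n × Fin n :=
  if p.2.val = 0 ∨ (p.2.val = 1 ∧ 1 < p.1.val) ∨ (p.1.val = n - 1 ∧ p.2.val + 1 ≤ n / 2) then
    (⟨p.1.val - 1, lt_of_le_of_lt (Nat.sub_le _ _) p.1.2⟩, p.2)
  else
    (p.1, ⟨p.2.val - 1, lt_of_le_of_lt (Nat.sub_le _ _) p.2.2⟩)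

/-- the configuration after a robot moves from node `u` to node `w` -/
def moveCfg {n : ℕ} (f : Fin n × Fin n → Fin 3) (u w : Fin n × Fin n) :
    Fin n × Fin n → Fin 3 :=
  fun p => if p = u then f u - 1 else if p = w then f w + 1 else f p

theorem aux_idx {n : ℕ} (i j : Fin n) : n * j.val + i.val < n * n := by
  have := i.2
  have : n * (j.val + 1) ≤ n * n := Nat.mul_le_mul_left _ j.2
  rw [Nat.mul_add] at this
  omega

/-- the index of (i,j) in column order -/
def auxK {n : ℕ} (i j : Fin n) : Fin (n * n) := ⟨n * j.val + i.val, aux_idx i j⟩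

theorem rowOf_auxK {n : ℕ} (i j : Fin n) : rowOf (auxK i j) = i := by
  apply Fin.ext
  simp [rowOf, auxK, Nat.mod_eq_of_lt i.2]

theorem colOf_auxK {n : ℕ} (i j : Fin n) : colOf (auxK i j) = j := by
  apply Fin.ext
  have hn : 0 < n := Nat.lt_of_le_of_lt (Nat.zero_le _) i.2
  simp [colOf, auxK, Nat.mul_add_div hn, Nat.div_eq_of_lt i.2]

theorem col_le_of_idx {n : ℕ} {i j a b : Fin n} (h : ¬ auxK a b < auxK i j) : j ≤ b := by
  simp only [auxK, Fin.lt_def, not_lt] at h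
  by_contra hc
  have h1 : b.val + 1 ≤ j.val := Fin.lt_def.1 (not_le.1 hc)
  have h2 := Nat.mul_le_mul_left n h1
  have := a.2
  rw [Nat.mul_add] at h2
  omega

/-- Structure of a configuration whose two D-sequences agree after removing first robots. -/
theorem aux_struct {n : ℕ} (g : Fin n × Fin n → Fin 3) (hm : NoMult g)
    (hz : zeroFirst (lamDA g) = zeroFirst (lamDC g)) (hs : g ≠ g ∘ symD) :
    ∃ r c : Fin n, r ≠ c ∧ g (r, c) ≠ 0 ∧ g (c, r) = 0 ∧
      (∀ a b, g (a, b) ≠ 0 → r ≤ a ∧ c ≤ b) ∧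
      (∀ a b, ¬ (a = r ∧ b = c) → ¬ (a = c ∧ b = r) → g (a, b) = g (b, a)) := by
  have h01 : ∀ p, g p = 0 ∨ g p = 1 := by
    intro p
    have := hm p
    generalize g p = x at *
    revert x; decide
  have key : ∀ i j, g (i, j) ≠ 0 → g (j, i) = 0 →
      (∀ a b, g (a, b) ≠ 0 → i ≤ a ∧ j ≤ b) ∧ (∀ k, k < auxK i j → lamDA g k = 0) := by
    intro i j h1 h2
    have e1 := congrFun hz (auxK i j)
    have e2 := congrFun hz (auxK j i)
    have a1 : lamDA g (auxK i j) = g (i, j) := by simp [lamDA, rowOf_auxK, colOf_auxK]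
    have a2 : lamDC g (auxK i j) = g (j, i) := by simp [lamDC, rowOf_auxK, colOf_auxK]
    have a3 : lamDA g (auxK j i) = g (j, i) := by simp [lamDA, rowOf_auxK, colOf_auxK]
    have a4 : lamDC g (auxK j i) = g (i, j) := by simp [lamDC, rowOf_auxK, colOf_auxK]
    simp only [zeroFirst, a1, a2, a3, a4, h2, ite_self] at e1 e2
    have P : ∀ k, k < auxK i j → lamDA g k = 0 := by
      by_contra hc
      rw [if_neg (fun h => hc h.2)] at e1
      exact h1 e1
    have Q : ∀ k, k < auxK j i → lamDC g k = 0 := by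
      by_contra hc
      rw [if_neg (fun h => hc h.2)] at e2
      exact h1 e2.symm
    refine ⟨fun a b hab => ⟨?_, ?_⟩, P⟩
    · apply col_le_of_idx (i := j) (a := b)
      intro hlt
      apply hab
      have := Q _ hlt
      simpa [lamDC, rowOf_auxK, colOf_auxK] using this
    · apply col_le_of_idx (i := i) (a := a)
      intro hlt
      apply hab
      have := P _ hlt
      simpa [lamDA, rowOf_auxK, colOf_auxK] using this
  have hex : ∃ i j, g (i, j) ≠ 0 ∧ g (j, i) = 0 := by
    by_contra hc
    push Not at hc
    apply hs
    funext p
    obtain ⟨i, j⟩ := p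
    have c1 := hc i j
    have c2 := hc j i
    simp only [Function.comp, symD]
    rcases h01 (i, j) with h | h <;> rcases h01 (j, i) with h' | h' <;> simp_all
  obtain ⟨r, c, h1, h2⟩ := hex
  have K := key r c h1 h2
  refine ⟨r, c, ?_, h1, h2, K.1, ?_⟩
  · rintro rfl
    exact h1 h2
  · intro a b n1 n2
    have uniq : ∀ a b, g (a, b) ≠ 0 → g (b, a) = 0 → a = r ∧ b = c := by
      intro a b x y
      have K' := (key a b x y).1 r c h1
      have K'' := K.1 a b x
      exact ⟨le_antisymm K'.1 K''.1, le_antisymm K'.2 K''.2⟩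
    rcases h01 (a, b) with h | h <;> rcases h01 (b, a) with h' | h'
    · rw [h, h']
    · have := uniq b a (by rw [h']; decide) h
      exact absurd ⟨this.2, this.1⟩ n2
    · have := uniq a b (by rw [h]; decide) h'
      exact absurd this n1
    · rw [h, h']

/-- If the second robot moves into (or inside) side DA, we get a contradiction. -/
theorem aux_main (n : ℕ) (hn : 4 ≤ n) (f f' : Fin n × Fin n → Fin 3)
    (hmax : DAStrictMax f) (hce : CornersEmpty f') (hnm : NoMult f') (has : Asymmetric f')
    (u₁ u₂ w : Fin n × Fin n)
    (hw : w.2.val = 0) (hu1w : u₁ ≠ w) (hfu1 : f' u₁ ≠ 0) (hfw : f' w ≠ 0) (hw0 : f w = 0)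
    (hsame : ∀ p, p ≠ u₂ → p ≠ w → f' p = f p)
    (hu2row : u₂.1.val ≠ n - 1)
    (hbelow : u₂.2.val = 0 → w.1.val < u₂.1.val)
    (hu1 : u₁.2.val = 0 ∨ (u₁.1.val = 0 ∧ u₁.2.val = 1 ∧ w.1.val = 1))
    (h : zeroFirst (lamAD f') = zeroFirst (lamAB f') ∨
      zeroFirst (lamCB f') = zeroFirst (lamCD f')) : False := by
  have hA : f' ≠ f' ∘ symA := has symA (by simp)
  obtain ⟨x, y⟩ := w
  obtain ⟨a, b⟩ := u₁
  simp only at hw hu1 hbelow hu2row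
  have hx0 : x.val ≠ 0 := fun e => hfw (hce _ (Or.inl e) (Or.inl hw))
  have hxn : x.val ≠ n - 1 := fun e => hfw (hce _ (Or.inr e) (Or.inl hw))
  have hxlt := x.2
  have halt := a.2
  rcases h with h | h
  · have hs : (f' ∘ symH) ≠ (f' ∘ symH) ∘ symD := by
      intro e
      apply hA
      funext p
      have := congrFun e (p.1.rev, p.2)
      simpa [symH, symD, symA] using this
    obtain ⟨r, c, hrc, g1, g2, g3, g4⟩ := aux_struct (f' ∘ symH) (fun p => hnm _) h hs
    have E : ∀ i j, (f' ∘ symH) (i, j) = f' (i.rev, j) := fun i j => rfl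
    have k1 := (g3 x.rev y (by rw [E, Fin.rev_rev]; exact hfw)).2
    have hc0 : c.val = 0 := by have := Fin.le_def.1 k1; omega
    have hr0 : r.val ≠ 0 := fun e => hrc (Fin.ext (by omega))
    have other : ∀ i j, f' (i, j) ≠ 0 → ¬ (i.rev = r ∧ j = c) → r ≤ j := by
      intro i j hij hne
      by_cases hT : i.rev = c ∧ j = r
      · exact hT.2.ge
      · have e := g4 i.rev j hne hT
        have : (f' ∘ symH) (i.rev, j) ≠ 0 := by rw [E, Fin.rev_rev]; exact hij
        rw [e] at this
        exact (g3 _ _ this).1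
    have hwp : x.rev = r ∧ y = c := by
      by_contra hc
      have := Fin.le_def.1 (other x y hfw hc)
      omega
    have hu1p : ¬ (a.rev = r ∧ b = c) := by
      rintro ⟨e1, e2⟩
      apply hu1w
      rw [Prod.mk.injEq]
      exact ⟨Fin.rev_injective (e1.trans hwp.1.symm), e2.trans hwp.2.symm⟩
    have k2 := Fin.le_def.1 (other a b hfu1 hu1p)
    have k3 : r.val = n - (x.val + 1) := by rw [← hwp.1, Fin.val_rev]
    omega
  · have hs : (f' ∘ symV) ≠ (f' ∘ symV) ∘ symD := by
      intro e
      apply hA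
      funext p
      have := congrFun e (p.1, p.2.rev)
      simpa [symV, symD, symA] using this
    obtain ⟨r, c, hrc, g1, g2, g3, g4⟩ := aux_struct (f' ∘ symV) (fun p => hnm _) h hs
    have E : ∀ i j, (f' ∘ symV) (i, j) = f' (i, j.rev) := fun i j => rfl
    have robW : (f' ∘ symV) (x, y.rev) ≠ 0 := by rw [E, Fin.rev_rev]; exact hfw
    have robU : (f' ∘ symV) (a, b.rev) ≠ 0 := by rw [E, Fin.rev_rev]; exact hfu1
    have hyr : (y.rev).val = n - 1 := by rw [Fin.val_rev]; omega
    have hrn : r.val ≠ n - 1 := by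
      intro e
      have := Fin.le_def.1 (g3 _ _ robW).1
      omega
    have hcn : c.val ≠ n - 1 := by
      intro e
      have hbr := Fin.le_def.1 (g3 _ _ robU).2
      rw [Fin.val_rev] at hbr
      have hb0 : b.val = 0 := by omega
      have hby : b = y := Fin.ext (by omega)
      have hcy : c = y.rev := Fin.ext (by omega)
      have gen : ∀ i, f' (i, y) ≠ 0 → i = r := by
        intro i hi
        by_contra hir
        have hi' : (f' ∘ symV) (i, y.rev) ≠ 0 := by rw [E, Fin.rev_rev]; exact hi
        have hT : ¬ (i = c ∧ y.rev = r) := by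
          rintro ⟨_, e2⟩
          apply hrn
          rw [← e2]; exact hyr
        have e4 := g4 i y.rev (fun hh => hir hh.1) hT
        rw [e4] at hi'
        have := Fin.le_def.1 (g3 _ _ hi').2
        have := i.2
        exact hi (hce _ (Or.inr (by simp only; omega)) (Or.inl hw))
      apply hu1w
      subst hby
      rw [gen a hfu1, gen x hfw]
    have sideEq : ∀ i : Fin n, f' (i, y) = f' (y.rev, i.rev) := by
      intro i
      have := g4 i y.rev (fun hh => hcn (by rw [← hh.2]; exact hyr))
        (fun hh => hrn (by rw [← hh.2]; exact hyr))
      rw [E, E, Fin.rev_rev] at this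
      exact this
    have botEq : ∀ i : Fin n, f' (y.rev, i.rev) = f (y.rev, i.rev) := by
      intro i
      apply hsame
      · intro e
        apply hu2row
        rw [← e]; exact hyr
      · intro e
        apply hxn
        rw [← (Prod.mk.injEq _ _ _ _ ▸ e : y.rev = x ∧ i.rev = y).1]; exact hyr
    have hlt : toLex (lamDA f) < toLex (lamBC f) := by
      refine ⟨auxK x y, ?_, ?_⟩
      · intro k hk
        have hk' : k.val < x.val := by
          have := Fin.lt_def.1 hk
          simpa [auxK, hw] using this
        have hkn : k.val < n := by omega
        have hkk : k = auxK ⟨k.val, hkn⟩ y := Fin.ext (by simp [auxK, hw])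
        have e1 : lamDA f k = f (⟨k.val, hkn⟩, y) := by
          conv_lhs => rw [hkk]
          simp [lamDA, rowOf_auxK, colOf_auxK]
        have e2 : lamBC f k = f (y.rev, Fin.rev ⟨k.val, hkn⟩) := by
          conv_lhs => rw [hkk]
          simp [lamBC, rowOf_auxK, colOf_auxK]
        change lamDA f k = lamBC f k
        rw [e1, e2, ← botEq, ← sideEq]
        symm
        apply hsame
        · intro e
          have h1 : u₂.1.val = k.val := by rw [← e]
          have h2 : u₂.2.val = 0 := by rw [← e]; exact hw
          have := hbelow h2
          omega
        · intro e
          have : k.val = x.val := by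
            have := congrArg (fun q => (Prod.fst q).val) e
            simpa using this
          omega
      · change lamDA f (auxK x y) < lamBC f (auxK x y)
        have e1 : lamDA f (auxK x y) = 0 := by
          simpa [lamDA, rowOf_auxK, colOf_auxK] using hw0
        have e2 : lamBC f (auxK x y) = f' (x, y) := by
          rw [sideEq, botEq]
          simp [lamBC, rowOf_auxK, colOf_auxK]
        rw [e1, e2]
        exact Fin.pos_iff_ne_zero.2 hfw
    exact absurd hlt (not_lt_of_gt (hmax (lamBC f) (by simp)))

/-- Lemma 5.1-2 (critical): in a critical configuration with largest corner D, the
second robot of the leading duo is not on side DA before its move, nor after it. -/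
theorem critical_second_robot_not_on_DA (n : ℕ) (hn : 4 ≤ n) (hne : Even n)
    (f : Fin n × Fin n → Fin 3) (hpa : PurelyAsym f)
    (u₁ u₂ : Fin n × Fin n)
    (h₁ : FirstRobot f u₁) (hsingle : f u₁ = 1) (h₂ : SecondRobot f u₁ u₂)
    (hcrit : AlmostSym2 (moveCfg f u₂ (destD u₂))) :
    u₂.2.val ≠ 0 ∧ (destD u₂).2.val ≠ 0 := by
  by_contra hcon
  obtain ⟨hce0, -, hmax, -, -⟩ := hpa
  obtain ⟨hce, hnm, has, -, hor⟩ := hcrit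
  obtain ⟨hu2, hne12, hmin2⟩ := h₂
  obtain ⟨hu1, hmin1⟩ := h₁
  have l11 := u₁.1.2
  have l21 := u₂.1.2
  have l12 := u₁.2.2
  have l22 := u₂.2.2
  -- shape of the move
  have shape : (u₂.2.val = 0 ∧ (destD u₂).2.val = 0 ∧ (destD u₂).1.val = u₂.1.val - 1) ∨
      (u₂.2.val = 1 ∧ u₂.1.val ≤ 1 ∧ (destD u₂).2.val = 0 ∧ (destD u₂).1.val = u₂.1.val) := by
    by_cases hc : u₂.2.val = 0 ∨ (u₂.2.val = 1 ∧ 1 < u₂.1.val) ∨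
        (u₂.1.val = n - 1 ∧ u₂.2.val + 1 ≤ n / 2)
    · have hd1 : (destD u₂).1.val = u₂.1.val - 1 := by unfold destD; rw [if_pos hc]
      have hd2 : (destD u₂).2.val = u₂.2.val := by unfold destD; rw [if_pos hc]
      rw [hd2] at hcon ⊢
      rw [hd1]
      have h0 : u₂.2.val = 0 := by
        by_contra h0
        exact hcon ⟨h0, h0⟩
      exact Or.inl ⟨h0, h0, rfl⟩
    · have hd1 : (destD u₂).1.val = u₂.1.val := by unfold destD; rw [if_neg hc]
      have hd2 : (destD u₂).2.val = u₂.2.val - 1 := by unfold destD; rw [if_neg hc]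
      rw [hd2] at hcon ⊢
      rw [hd1]
      push Not at hc
      have h1 : u₂.2.val = 1 := by
        by_contra h1
        exact hcon ⟨hc.1, by omega⟩
      right
      refine ⟨h1, ?_, by omega, rfl⟩
      exact hc.2.1 h1
  generalize destD u₂ = w at *
  have hu2c : u₂.2.val = 0 → u₂.1.val ≠ 0 ∧ u₂.1.val ≠ n - 1 := fun e =>
    ⟨fun e' => hu2 (hce0 _ (Or.inl e') (Or.inl e)), fun e' => hu2 (hce0 _ (Or.inr e') (Or.inl e))⟩
  have hidx : idxDA w < idxDA u₂ := by
    unfold idxDA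
    rcases shape with ⟨s1, s2, s3⟩ | ⟨s1, s2, s3, s4⟩
    · rw [s1, s2, s3]; have := hu2c s1; omega
    · rw [s1, s3, s4]; omega
  have hwu2 : w ≠ u₂ := fun e => by rw [e] at hidx; omega
  have hu1w : u₁ ≠ w := by
    intro e
    apply hnm w
    unfold moveCfg
    rw [if_neg hwu2, if_pos rfl, ← e, hsingle]
    decide
  have hw0 : f w = 0 := by
    by_contra hc
    have := hmin2 w hc hu1w.symm
    omega
  have hfw : moveCfg f u₂ w w ≠ 0 := by
    unfold moveCfg
    rw [if_neg hwu2, if_pos rfl, hw0]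
    decide
  have hfu1 : moveCfg f u₂ w u₁ ≠ 0 := by
    unfold moveCfg
    rw [if_neg hne12.symm, if_neg hu1w]
    exact hu1
  have hw2 : w.2.val = 0 := by rcases shape with s | s; exacts [s.2.1, s.2.2.1]
  have hw1 : w.1.val ≠ 0 := fun e => hfw (hce _ (Or.inl e) (Or.inl hw2))
  have hle := hmin1 u₂ hu2
  have hu1pos : u₁.2.val = 0 ∨ (u₁.1.val = 0 ∧ u₁.2.val = 1 ∧ w.1.val = 1) := by
    by_contra hc
    push Not at hc
    have h1 : 1 ≤ u₁.2.val := by omega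
    have h3 := Nat.mul_le_mul_left n h1
    unfold idxDA at hle
    rcases shape with ⟨s1, s2, s3⟩ | ⟨s1, s2, s3, s4⟩
    · rw [s1] at hle; omega
    · rw [s1] at hle
      have h4 : u₁.2.val = 1 := by
        by_contra h5
        have h6 := Nat.mul_le_mul_left n (show 2 ≤ u₁.2.val by omega)
        omega
      rw [h4] at hle
      have h7 : u₁.1.val ≠ 0 := by
        intro e
        exact hc.2 e h4 (by omega)
      apply hne12
      refine Prod.ext (Fin.ext ?_) (Fin.ext ?_) <;> omega
  refine aux_main n hn f (moveCfg f u₂ w) hmax hce hnm has u₁ u₂ w hw2 hu1w hfu1 hfw hw0 ?_ ?_ ?_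
    hu1pos ?_
  · intro p p1 p2
    unfold moveCfg
    rw [if_neg p1, if_neg p2]
  · rcases shape with s | s
    · exact (hu2c s.1).2
    · omega
  · intro e
    have := hu2c e
    omega
  · rcases hor with s | s
    · exact Or.inl s.2
    · exact Or.inr s.2
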